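/- Let X be reflexive and separable, let x̄ ∈ F be a feasible point of problem (P) which is s-AKKT regular, and assume condition (CC) holds. Then Guignard's constraint qualification holds at x̄, i.e., (T^w_F(x̄))° = M(x̄, 0). -/

import Mathlib

open Filter Topology MeasureTheory

section AKKTDefs

variable {X Y : Type*} [NormedAddCommGroup X] [NormedSpace ℝ X]
  [NormedAddCommGroup Y] [NormedSpace ℝ Y]

/-- The normal cone (in the sense of convex analysis) to `C` at `x`;
it is empty whenever `x ∉ C`. -/
def normalCone (C : Set X) (x : X) : Set (X →L[ℝ] ℝ) :=
  {v | x ∈ C ∧ ∀ z ∈ C, v (z - x) ≤ 0}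

/-- The polar cone of a set `A ⊆ X`, as a subset of the topological dual. -/
def polarCone (A : Set X) : Set (X →L[ℝ] ℝ) :=
  {v | ∀ x ∈ A, v x ≤ 0}

/-- The recession cone of `S`: all `d` with `d + S ⊆ S`. -/
def recessionCone (S : Set X) : Set X :=
  {d | ∀ x ∈ S, d + x ∈ S}

/-- The radial cone (cone of feasible directions) of `S` at `x0`. -/
def radialCone (S : Set X) (x0 : X) : Set X :=
  {d | ∃ α : ℝ, 0 ≤ α ∧ ∃ x ∈ S, d = α • (x - x0)}

/-- Weak sequential convergence `x k ⇀ x0`. -/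
def WeakSeqConv (x : ℕ → X) (x0 : X) : Prop :=
  ∀ φ : X →L[ℝ] ℝ, Tendsto (fun k => φ (x k)) atTop (𝓝 (φ x0))

/-- Weak-* sequential convergence of functionals `v k →* v0`. -/
def WeakStarSeqConv (v : ℕ → X →L[ℝ] ℝ) (v0 : X →L[ℝ] ℝ) : Prop :=
  ∀ z : X, Tendsto (fun k => v k z) atTop (𝓝 (v0 z))

/-- `r^k ↓ 0`: nonnegative, monotonically decreasing, converging to `0`. -/
def DownTo0 (r : ℕ → ℝ) : Prop :=
  (∀ k, 0 ≤ r k) ∧ Antitone r ∧ Tendsto r atTop (𝓝 0)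

/-- The (Bouligand) tangent cone to `Q` at `x0`. -/
def tangentCone (Q : Set X) (x0 : X) : Set X :=
  {d | ∃ (x : ℕ → X) (t : ℕ → ℝ), (∀ k, x k ∈ Q) ∧ (∀ k, 0 < t k) ∧ Antitone t ∧
    Tendsto t atTop (𝓝 0) ∧ Tendsto x atTop (𝓝 x0) ∧
    Tendsto (fun k => (t k)⁻¹ • (x k - x0)) atTop (𝓝 d)}

/-- The weak tangent cone to `Q` at `x0`. -/
def weakTangentCone (Q : Set X) (x0 : X) : Set X :=
  {d | ∃ (x : ℕ → X) (t : ℕ → ℝ), (∀ k, x k ∈ Q) ∧ (∀ k, 0 < t k) ∧ Antitone t ∧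
    Tendsto t atTop (𝓝 0) ∧ Tendsto x atTop (𝓝 x0) ∧
    WeakSeqConv (fun k => (t k)⁻¹ • (x k - x0)) d}

/-- The Clarke tangent cone to `Q` at `x0`. -/
def clarkeTangentCone (Q : Set X) (x0 : X) : Set X :=
  {d | ∀ (x : ℕ → X) (t : ℕ → ℝ), (∀ k, x k ∈ Q) → Tendsto x atTop (𝓝 x0) →
    (∀ k, 0 < t k) → Antitone t → Tendsto t atTop (𝓝 0) →
    ∃ dk : ℕ → X, Tendsto dk atTop (𝓝 d) ∧ ∀ k, x k + t k • dk k ∈ Q}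

/-- The Fréchet (regular) normal cone to `Q` at `x0`. -/
def frechetNormalCone (Q : Set X) (x0 : X) : Set (X →L[ℝ] ℝ) :=
  {v | ∀ ε > 0, ∃ δ > 0, ∀ x ∈ Q, ‖x - x0‖ ≤ δ → v (x - x0) ≤ ε * ‖x - x0‖}

/-- A normed space is reflexive if the canonical embedding into the double dual
is surjective. -/
def IsReflexiveSpace (Z : Type*) [NormedAddCommGroup Z] [NormedSpace ℝ Z] : Prop :=
  Function.Surjective (NormedSpace.inclusionInDoubleDual ℝ Z)

/-- The set `M(x, r)` of inexact KKT multiples: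
`M(x,r) = {G'(x)*λ + μ : μ ∈ N_C(x), ⟨λ, y - G(x)⟩ ≤ r ∀ y ∈ K}`. -/
def Mset (G : X → Y) (G' : X → X →L[ℝ] Y) (C : Set X) (K : Set Y)
    (x : X) (r : ℝ) : Set (X →L[ℝ] ℝ) :=
  {v | ∃ (l : Y →L[ℝ] ℝ) (μ : X →L[ℝ] ℝ), μ ∈ normalCone C x ∧
    (∀ y ∈ K, l (y - G x) ≤ r) ∧ v = l.comp (G' x) + μ}

/-- KKT point of problem (P). -/
def KKTPoint (f' : X → X →L[ℝ] ℝ) (G : X → Y) (G' : X → X →L[ℝ] Y)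
    (C : Set X) (K : Set Y) (x0 : X) : Prop :=
  ∃ l : Y →L[ℝ] ℝ, (-(f' x0) - l.comp (G' x0)) ∈ normalCone C x0 ∧
    l ∈ normalCone K (G x0)

/-- `x0` is an s-AKKT point: there is an s-AKKT sequence with `x k → x0` in norm. -/
def sAKKTPoint (f' : X → X →L[ℝ] ℝ) (G : X → Y) (G' : X → X →L[ℝ] Y)
    (C : Set X) (K : Set Y) (x0 : X) : Prop :=
  ∃ (x : ℕ → X) (l : ℕ → Y →L[ℝ] ℝ) (ε : ℕ → X →L[ℝ] ℝ) (r : ℕ → ℝ),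
    Tendsto ε atTop (𝓝 0) ∧ DownTo0 r ∧
    (∀ k, (ε k - f' (x k) - (l k).comp (G' (x k))) ∈ normalCone C (x k)) ∧
    (∀ k, ∀ y ∈ K, (l k) (y - G (x k)) ≤ r k) ∧
    Tendsto x atTop (𝓝 x0)

/-- `x0` is a w-AKKT point: there is a w-AKKT sequence with `x k ⇀ x0` weakly. -/
def wAKKTPoint (f' : X → X →L[ℝ] ℝ) (G : X → Y) (G' : X → X →L[ℝ] Y)
    (C : Set X) (K : Set Y) (x0 : X) : Prop :=
  ∃ (x : ℕ → X) (l : ℕ → Y →L[ℝ] ℝ) (ε : ℕ → X →L[ℝ] ℝ) (r : ℕ → ℝ),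
    WeakStarSeqConv ε 0 ∧ DownTo0 r ∧
    (∀ k, (ε k - f' (x k) - (l k).comp (G' (x k))) ∈ normalCone C (x k)) ∧
    (∀ k, ∀ y ∈ K, (l k) (y - G (x k)) ≤ r k) ∧
    WeakSeqConv x x0

/-- s-AKKT regularity at `x0`. -/
def sAKKTRegular (G : X → Y) (G' : X → X →L[ℝ] Y) (C : Set X) (K : Set Y)
    (x0 : X) : Prop :=
  ∀ (v0 : X →L[ℝ] ℝ) (x : ℕ → X) (r : ℕ → ℝ) (v : ℕ → X →L[ℝ] ℝ),
    Tendsto x atTop (𝓝 x0) → DownTo0 r → Tendsto v atTop (𝓝 v0) →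
    (∀ k, v k ∈ Mset G G' C K (x k) (r k)) → v0 ∈ Mset G G' C K x0 0

/-- sw-AKKT regularity at `x0`. -/
def swAKKTRegular (G : X → Y) (G' : X → X →L[ℝ] Y) (C : Set X) (K : Set Y)
    (x0 : X) : Prop :=
  ∀ (v0 : X →L[ℝ] ℝ) (x : ℕ → X) (r : ℕ → ℝ) (v : ℕ → X →L[ℝ] ℝ),
    Tendsto x atTop (𝓝 x0) → DownTo0 r → WeakStarSeqConv v v0 →
    (∀ k, v k ∈ Mset G G' C K (x k) (r k)) → v0 ∈ Mset G G' C K x0 0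

/-- w-AKKT regularity at `x0`. -/
def wAKKTRegular (G : X → Y) (G' : X → X →L[ℝ] Y) (C : Set X) (K : Set Y)
    (x0 : X) : Prop :=
  ∀ (v0 : X →L[ℝ] ℝ) (x : ℕ → X) (r : ℕ → ℝ) (v : ℕ → X →L[ℝ] ℝ),
    WeakSeqConv x x0 → DownTo0 r → WeakStarSeqConv v v0 →
    (∀ k, v k ∈ Mset G G' C K (x k) (r k)) → v0 ∈ Mset G G' C K x0 0

/-- Condition (CC) from the paper. -/
def CondCC (G : X → Y) (C : Set X) (K : Set Y) : Prop :=
  ∀ (x : ℕ → X) (z : X), (∀ k, x k ∈ C) → z ∈ C → WeakSeqConv x z →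
    Tendsto (fun k => Metric.infDist (G (x k)) K) atTop (𝓝 0) → G z ∈ K

end AKKTDefs


lemma aux_ekeland {X : Type*} [MetricSpace X] [CompleteSpace X] (S : Set X) (hS : IsClosed S)
    (h : X → ℝ) (hc : Continuous h) (m : ℝ) (hm : ∀ x ∈ S, m ≤ h x) (x0 : X) (hx0 : x0 ∈ S)
    (ε : ℝ) (hε : 0 < ε) :
    ∃ x ∈ S, h x ≤ h x0 ∧ ∀ y ∈ S, h x ≤ h y + ε * dist y x := by
  let A : X → Set X := fun x => {y | y ∈ S ∧ h y + ε * dist y x ≤ h x}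
  have hself : ∀ x ∈ S, x ∈ A x := fun x hx => ⟨hx, by simp⟩
  have htrans : ∀ x y z, y ∈ A x → z ∈ A y → z ∈ A x := by
    rintro x y z ⟨_, hy⟩ ⟨hz, hz'⟩
    refine ⟨hz, ?_⟩
    nlinarith [dist_triangle z y x]
  have step : ∀ (n : ℕ) (x : X), ∃ y, x ∈ S → (y ∈ A x ∧ ∀ z ∈ A x, h y ≤ h z + 1 / ((n : ℝ) + 1)) := by
    intro n x
    by_cases hx : x ∈ S
    · have hne : (h '' A x).Nonempty := ⟨h x, x, hself x hx, rfl⟩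
      have hbd : BddBelow (h '' A x) := ⟨m, by rintro _ ⟨y, hy, rfl⟩; exact hm y hy.1⟩
      have hpos : (0 : ℝ) < 1 / ((n : ℝ) + 1) := by positivity
      obtain ⟨_, ⟨y, hy, rfl⟩, hlt⟩ := exists_lt_of_csInf_lt hne (lt_add_of_pos_right (sInf (h '' A x)) hpos)
      refine ⟨y, fun _ => ⟨hy, fun z hz => ?_⟩⟩
      have := csInf_le hbd ⟨z, hz, rfl⟩
      linarith
    · exact ⟨x, fun h => absurd h hx⟩
  choose F hF using step
  let x : ℕ → X := fun n => Nat.rec x0 (fun n y => F n y) n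
  have hxs : ∀ n, x (n + 1) = F n (x n) := fun n => rfl
  have hxS : ∀ n, x n ∈ S := by
    intro n
    induction n with
    | zero => exact hx0
    | succ n ih => rw [hxs]; exact (hF n _ ih).1.1
  have hxA : ∀ n k, x (n + k) ∈ A (x n) := by
    intro n k
    induction k with
    | zero => exact hself _ (hxS n)
    | succ k ih =>
      refine htrans _ _ _ ih ?_
      rw [← add_assoc, hxs]
      exact (hF _ _ (hxS _)).1
  have hxA' : ∀ n k, n ≤ k → x k ∈ A (x n) := by
    intro n k hnk
    obtain ⟨j, rfl⟩ := Nat.exists_eq_add_of_le hnk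
    exact hxA n j
  have hanti : Antitone (fun n => h (x n)) := by
    intro n k hnk
    have h1 := (hxA' n k hnk).2
    have := mul_nonneg hε.le (dist_nonneg (x := x k) (y := x n))
    simp only
    linarith
  have hbd : BddBelow (Set.range fun n => h (x n)) := ⟨m, by rintro _ ⟨n, rfl⟩; exact hm _ (hxS n)⟩
  have hlim := tendsto_atTop_ciInf hanti hbd
  set L := ⨅ n, h (x n)
  have hLle : ∀ n, L ≤ h (x n) := fun n => ciInf_le hbd n
  have hcau : CauchySeq x := by
    refine cauchySeq_of_le_tendsto_0' (fun n => (h (x n) - L) / ε) ?_ ?_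
    · intro n k hnk
      have h1 := (hxA' n k hnk).2
      rw [le_div_iff₀ hε, dist_comm]
      linarith [hLle k]
    · have : Tendsto (fun n => (h (x n) - L) / ε) atTop (𝓝 ((L - L) / ε)) :=
        (hlim.sub_const L).div_const ε
      simpa using this
  obtain ⟨z, hz⟩ := cauchySeq_tendsto_of_complete hcau
  have hzS : z ∈ S := hS.mem_of_tendsto hz (Eventually.of_forall hxS)
  have hzA : ∀ n, z ∈ A (x n) := by
    intro n
    refine ⟨hzS, ?_⟩
    have h1 : Tendsto (fun k => h (x k) + ε * dist (x k) (x n)) atTop (𝓝 (h z + ε * dist z (x n))) :=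
      ((hc.tendsto z).comp hz).add ((hz.dist tendsto_const_nhds).const_mul ε)
    exact le_of_tendsto h1 (eventually_atTop.2 ⟨n, fun k hk => (hxA' n k hk).2⟩)
  refine ⟨z, hzS, ?_, ?_⟩
  · have := (hzA 0).2
    have h2 := mul_nonneg hε.le (dist_nonneg (x := z) (y := x 0))
    change _ ≤ h (x 0)
    linarith
  · intro y hy
    by_contra hcon
    push Not at hcon
    have hyz : y ∈ A z := ⟨hy, hcon.le⟩
    have h1 : ∀ n : ℕ, h (x (n+1)) ≤ h y + 1 / ((n : ℝ) + 1) := fun n =>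
      (hF n (x n) (hxS n)).2 y (htrans _ _ _ (hzA n) hyz)
    have h2 : Tendsto (fun n => h (x (n+1))) atTop (𝓝 (h z)) :=
      ((hc.tendsto z).comp hz).comp (tendsto_add_atTop_nat 1)
    have h3 : Tendsto (fun n : ℕ => h y + 1 / ((n : ℝ) + 1)) atTop (𝓝 (h y + 0)) :=
      tendsto_one_div_add_atTop_nhds_zero_nat.const_add _
    have h4 := le_of_tendsto_of_tendsto' h2 h3 h1
    have := mul_nonneg hε.le (dist_nonneg (x := y) (y := z))
    linarith

lemma aux_dual_sep {X : Type*} [NormedAddCommGroup X] [NormedSpace ℝ X]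
    [TopologicalSpace.SeparableSpace X]
    (hrefl : Function.Surjective (NormedSpace.inclusionInDoubleDual ℝ X)) :
    TopologicalSpace.SeparableSpace (StrongDual ℝ X) := by
  have hn : ∀ n : ℕ, ∃ g : StrongDual ℝ X, ‖g‖ ≤ 1 ∧
      g (TopologicalSpace.denseSeq X n) = ‖TopologicalSpace.denseSeq X n‖ := fun n =>
    exists_dual_vector'' ℝ _
  choose g hg1 hg2 using hn
  let V : Submodule ℝ (StrongDual ℝ X) := (Submodule.span ℝ (Set.range g)).topologicalClosure
  have htop : V = ⊤ := by
    by_contra hV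
    obtain ⟨w, hw⟩ : ∃ w, w ∉ V := by
      by_contra! hcon
      exact hV (eq_top_iff.2 fun w _ => hcon w)
    obtain ⟨f, u, hf, hu⟩ := geometric_hahn_banach_closed_point (s := (V : Set (StrongDual ℝ X)))
      V.convex (Submodule.isClosed_topologicalClosure _) hw
    have hf0 : ∀ a ∈ V, f a = 0 := by
      intro a ha
      by_contra hne
      have := hf (((u + 1) / f a) • a) (V.smul_mem _ ha)
      rw [map_smul, smul_eq_mul, div_mul_cancel₀ _ hne] at this
      linarith
    obtain ⟨x, rfl⟩ := hrefl f
    have hgx : ∀ n, g n x = 0 := fun n => by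
      have := hf0 (g n) (Submodule.le_topologicalClosure _ (Submodule.subset_span ⟨n, rfl⟩))
      simpa using this
    have hx : x = 0 := by
      by_contra hx
      have hpos : 0 < ‖x‖ := norm_pos_iff.2 hx
      obtain ⟨n, hn⟩ := (TopologicalSpace.denseRange_denseSeq X).exists_dist_lt x
        (ε := ‖x‖ / 2) (by positivity)
      set q := TopologicalSpace.denseSeq X n
      rw [dist_eq_norm] at hn
      have h1 : ‖q‖ = g n (q - x) := by rw [map_sub, hgx, hg2]; simp [q]
      have h2 : g n (q - x) ≤ ‖q - x‖ := by
        calc g n (q - x) ≤ ‖g n (q - x)‖ := le_abs_self _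
          _ ≤ ‖g n‖ * ‖q - x‖ := (g n).le_opNorm _
          _ ≤ 1 * ‖q - x‖ := by gcongr; exact hg1 n
          _ = _ := one_mul _
      rw [norm_sub_rev] at h2
      have h3 : ‖x‖ ≤ ‖x - q‖ + ‖q‖ := by
        simpa using norm_add_le (x - q) q
      linarith
    have h0 : (0:ℝ) < u := by simpa using hf 0 V.zero_mem
    subst hx
    simp at hu
    linarith
  have hsep : TopologicalSpace.IsSeparable (Submodule.span ℝ (Set.range g) : Set (StrongDual ℝ X)) :=
    (Set.countable_range g).isSeparable.span
  have h2 := hsep.closure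
  rw [← Submodule.topologicalClosure_coe] at h2
  change TopologicalSpace.IsSeparable (V : Set (StrongDual ℝ X)) at h2
  rw [htop] at h2
  exact TopologicalSpace.isSeparable_univ_iff.1 (by simpa using h2)

lemma aux_weak_compact {X : Type*} [NormedAddCommGroup X] [NormedSpace ℝ X]
    [TopologicalSpace.SeparableSpace X]
    (hrefl : Function.Surjective (NormedSpace.inclusionInDoubleDual ℝ X))
    (x : ℕ → X) (R : ℝ) (hR : ∀ n, ‖x n‖ ≤ R) :
    ∃ (z : X) (φ : ℕ → ℕ), StrictMono φ ∧
      ∀ f : X →L[ℝ] ℝ, Tendsto (fun k => f (x (φ k))) atTop (𝓝 (f z)) := by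
  have := aux_dual_sep hrefl
  have hc := WeakDual.isSeqCompact_closedBall ℝ (StrongDual ℝ X) 0 R
  obtain ⟨a, _, φ, hφ, ht⟩ := hc (x := fun n => StrongDual.toWeakDual (NormedSpace.inclusionInDoubleDual ℝ X (x n)))
    (fun n => by
      simp only [Set.mem_preimage, mem_closedBall_zero_iff]
      exact (NormedSpace.double_dual_bound ℝ X (x n)).trans (hR n))
  obtain ⟨z, hz⟩ := hrefl (WeakDual.toStrongDual a)
  refine ⟨z, φ, hφ, fun f => ?_⟩
  have h1 := (WeakDual.eval_continuous (𝕜 := ℝ) f).tendsto a |>.comp ht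
  have h2 : a f = f z := by
    have := congrArg (fun q => q f) hz
    simpa using this.symm
  rw [← h2]
  exact h1

lemma aux_weak_closed {X : Type*} [NormedAddCommGroup X] [NormedSpace ℝ X] (S : Set X)
    (hS : IsClosed S) (hcv : Convex ℝ S) (x : ℕ → X) (z : X) (hx : ∀ k, x k ∈ S)
    (hw : WeakSeqConv x z) : z ∈ S := by
  by_contra hz
  obtain ⟨f, u, hf, hu⟩ := geometric_hahn_banach_closed_point hcv hS hz
  have := le_of_tendsto' (hw f) (fun k => (hf _ (hx k)).le)
  linarith

lemma aux_infDist_convex {Y : Type*} [NormedAddCommGroup Y] [NormedSpace ℝ Y] (K : Set Y)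
    (hne : K.Nonempty) (hcv : Convex ℝ K) (p q : Y) (a b : ℝ) (ha : 0 ≤ a) (hb : 0 ≤ b)
    (hab : a + b = 1) :
    Metric.infDist (a • p + b • q) K ≤ a * Metric.infDist p K + b * Metric.infDist q K := by
  refine le_of_forall_pos_le_add fun ε hε => ?_
  obtain ⟨y, hy, hy'⟩ := (Metric.infDist_lt_iff hne).1 (lt_add_of_pos_right (Metric.infDist p K) hε)
  obtain ⟨z, hz, hz'⟩ := (Metric.infDist_lt_iff hne).1 (lt_add_of_pos_right (Metric.infDist q K) hε)
  have h1 := Metric.infDist_le_dist_of_mem (x := a • p + b • q) (hcv hy hz ha hb hab)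
  have h2 : dist (a • p + b • q) (a • y + b • z) ≤ a * dist p y + b * dist q z := by
    refine (dist_add_add_le _ _ _ _).trans ?_
    rw [dist_smul₀, dist_smul₀, Real.norm_of_nonneg ha, Real.norm_of_nonneg hb]
  have h3 := mul_le_mul_of_nonneg_left hy'.le ha
  have h4 := mul_le_mul_of_nonneg_left hz'.le hb
  have h5 : a * ε + b * ε = ε := by rw [← add_mul, hab, one_mul]
  linarith

lemma aux_multiplier {X Y : Type*} [NormedAddCommGroup X] [NormedSpace ℝ X]
    [NormedAddCommGroup Y] [NormedSpace ℝ Y] (C : Set X) (K : Set Y)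
    (hCcv : Convex ℝ C) (hKne : K.Nonempty) (hKcv : Convex ℝ K)
    (x : X) (hx : x ∈ C) (v : X →L[ℝ] ℝ) (A : X →L[ℝ] Y) (g : Y) (e k : ℝ)
    (he : 0 ≤ e) (hk : 0 ≤ k)
    (H : ∀ c ∈ C, 0 ≤ -v (c - x) + e * ‖c - x‖ +
      k * (Metric.infDist (g + A (c - x)) K - Metric.infDist g K)) :
    ∃ (l : Y →L[ℝ] ℝ) (μ p : X →L[ℝ] ℝ), μ ∈ normalCone C x ∧ (∀ y ∈ K, l (y - g) ≤ 0) ∧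
      ‖p‖ ≤ e ∧ v = p + (l.comp A + μ) := by
  let Ψ : X → X × Y → ℝ := fun c q => -v (c - x) + e * ‖c - x + q.1‖ +
      k * (Metric.infDist (g + A (c - x) + q.2) K - Metric.infDist g K)
  have hΨc : ∀ c, Continuous (Ψ c) := by
    intro c
    have : Continuous fun q : X × Y => Metric.infDist (g + A (c - x) + q.2) K :=
      (Metric.continuous_infDist_pt K).comp (by fun_prop)
    simp only [Ψ]
    fun_prop
  let E : Set ((X × Y) × ℝ) := {s | ∃ c ∈ C, Ψ c s.1 < s.2}
  have hEo : IsOpen E := by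
    have : E = ⋃ c ∈ C, {s : (X × Y) × ℝ | Ψ c s.1 < s.2} := by
      ext s; simp [E]
    rw [this]
    refine isOpen_biUnion fun c _ => ?_
    exact isOpen_lt ((hΨc c).comp continuous_fst) continuous_snd
  have hEc : Convex ℝ E := by
    rintro ⟨q, s⟩ ⟨c, hc, h1⟩ ⟨q', s'⟩ ⟨c', hc', h2⟩ a b ha hb hab
    refine ⟨a • c + b • c', hCcv hc hc' ha hb hab, ?_⟩
    simp only at h1 h2
    have hlt : a * Ψ c q + b * Ψ c' q' < a * s + b * s' := by
      rcases ha.eq_or_lt with rfl | ha'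
      · have : b = 1 := by linarith
        subst this
        linarith
      · have := mul_lt_mul_of_pos_left h1 ha'
        have := mul_le_mul_of_nonneg_left h2.le hb
        linarith
    refine lt_of_le_of_lt ?_ hlt
    have hcx : a • c + b • c' - x = a • (c - x) + b • (c' - x) := by
      have : x = a • x + b • x := by rw [← add_smul, hab, one_smul]
      nth_rewrite 1 [this]
      simp only [smul_sub]; abel
    have hg : g = a • g + b • g := by rw [← add_smul, hab, one_smul]
    have hn : ‖a • c + b • c' - x + (a • q.1 + b • q'.1)‖ ≤ a * ‖c - x + q.1‖ + b * ‖c' - x + q'.1‖ := by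
      have : a • c + b • c' - x + (a • q.1 + b • q'.1) = a • (c - x + q.1) + b • (c' - x + q'.1) := by
        rw [hcx]; simp only [smul_add]; abel
      rw [this]
      refine (norm_add_le _ _).trans ?_
      rw [norm_smul, norm_smul, Real.norm_of_nonneg ha, Real.norm_of_nonneg hb]
    have hd : Metric.infDist (g + A (a • c + b • c' - x) + (a • q.2 + b • q'.2)) K ≤
        a * Metric.infDist (g + A (c - x) + q.2) K + b * Metric.infDist (g + A (c' - x) + q'.2) K := by
      have : g + A (a • c + b • c' - x) + (a • q.2 + b • q'.2) =
          a • (g + A (c - x) + q.2) + b • (g + A (c' - x) + q'.2) := by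
        nth_rewrite 1 [hg]
        rw [hcx, map_add, map_smul, map_smul]; simp only [smul_add]; abel
      rw [this]
      exact aux_infDist_convex K hKne hKcv _ _ a b ha hb hab
    have hv : v (a • c + b • c' - x) = a * v (c - x) + b * v (c' - x) := by
      rw [hcx, map_add, map_smul, map_smul]; rfl
    have hn' := mul_le_mul_of_nonneg_left hn he
    have hd' := mul_le_mul_of_nonneg_left hd hk
    have hD : k * Metric.infDist g K = a * (k * Metric.infDist g K) + b * (k * Metric.infDist g K) := by
      rw [← add_mul, hab, one_mul]
    simp only [Ψ, Prod.fst_add, Prod.snd_add, Prod.smul_fst, Prod.smul_snd]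
    rw [hv]
    nlinarith
  have h0 : (0 : (X × Y) × ℝ) ∉ E := by
    rintro ⟨c, hc, h1⟩
    have := H c hc
    simp [Ψ] at h1
    rw [map_sub] at this
    simp only [map_sub] at this
    linarith
  obtain ⟨F, hF⟩ := geometric_hahn_banach_open_point hEc hEo h0
  rw [map_zero] at hF
  set α := F ((0, 0), 1) with hα
  have hαneg : α < 0 := hF _ ⟨x, hx, by simp [Ψ]⟩
  have hsplit : ∀ u w s, F ((u, w), s) = F ((u, 0), 0) + F ((0, w), 0) + s * α := by
    intro u w s
    have : (((u, w), s) : (X × Y) × ℝ) = ((u, 0), 0) + ((0, w), 0) + s • ((0, 0), 1) := by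
      simp
    rw [this, map_add, map_add, map_smul]; rfl
  let iX : X →L[ℝ] (X × Y) × ℝ :=
    (ContinuousLinearMap.inl ℝ (X × Y) ℝ).comp (ContinuousLinearMap.inl ℝ X Y)
  let iY : Y →L[ℝ] (X × Y) × ℝ :=
    (ContinuousLinearMap.inl ℝ (X × Y) ℝ).comp (ContinuousLinearMap.inr ℝ X Y)
  let p : X →L[ℝ] ℝ := (-α)⁻¹ • F.comp iX
  let l : Y →L[ℝ] ℝ := (-α)⁻¹ • F.comp iY
  have hα' : 0 < -α := by linarith
  have hsub : ∀ c ∈ C, ∀ u w, p u + l w ≤ Ψ c (u, w) := by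
    intro c hc u w
    refine le_of_forall_pos_le_add fun ε hε => ?_
    have h1 := hF ((u, w), Ψ c (u, w) + ε) ⟨c, hc, by simp; exact hε⟩
    rw [hsplit] at h1
    have h2 : p u + l w = (-α)⁻¹ * (F ((u, 0), 0) + F ((0, w), 0)) := by
      simp [p, l, iX, iY]; ring
    rw [h2, inv_mul_le_iff₀ hα']
    linarith
  refine ⟨l, v - p - l.comp A, p, ⟨hx, ?_⟩, ?_, ?_, by abel⟩
  · intro c hc
    have := hsub c hc (-(c - x)) (-A (c - x))
    simp only [Ψ, add_neg_cancel, norm_zero, mul_zero, add_neg_cancel_right, sub_self, map_neg] at this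
    simp only [sub_apply, ContinuousLinearMap.comp_apply]
    linarith
  · intro y hy
    have := hsub x hx 0 (y - g)
    simp only [Ψ, sub_self, map_zero, add_zero, norm_zero, mul_zero, add_sub_cancel,
      Metric.infDist_zero_of_mem hy] at this
    have h2 := mul_nonneg hk (Metric.infDist_nonneg (x := g) (s := K))
    linarith
  · have hle : ∀ u, p u ≤ e * ‖u‖ := by
      intro u
      have := hsub x hx u 0
      simpa [Ψ] using this
    refine p.opNorm_le_bound he fun u => ?_
    rw [Real.norm_eq_abs, abs_le]
    refine ⟨?_, hle u⟩
    have := hle (-u)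
    rw [map_neg, norm_neg] at this
    linarith

lemma aux_weak_bounded {X : Type*} [NormedAddCommGroup X] [NormedSpace ℝ X]
    (s : ℕ → X) (d : X) (h : WeakSeqConv s d) : ∃ B, ∀ n, ‖s n‖ ≤ B := by
  obtain ⟨B, hB⟩ := banach_steinhaus (g := fun n => NormedSpace.inclusionInDoubleDual ℝ X (s n))
    (fun f => by
      obtain ⟨B, hB⟩ := (Metric.isBounded_range_of_tendsto _ (h f)).exists_norm_le
      exact ⟨B, fun n => by simpa using hB _ ⟨n, rfl⟩⟩)
  refine ⟨B, fun n => ?_⟩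
  rw [← (NormedSpace.inclusionInDoubleDualLi ℝ (E := X)).norm_map (s n)]
  exact hB n

lemma aux_easy {X Y : Type*} [NormedAddCommGroup X] [NormedSpace ℝ X]
    [NormedAddCommGroup Y] [NormedSpace ℝ Y]
    (G : X → Y) (G' : X → X →L[ℝ] Y)
    (hGd : ∀ x, HasFDerivAt G (G' x) x)
    (C : Set X) (K : Set Y) (xbar : X) :
    Mset G G' C K xbar 0 ⊆ polarCone (weakTangentCone {x | x ∈ C ∧ G x ∈ K} xbar) := by
  rintro v ⟨l, μ, hμ, hl, rfl⟩ d ⟨x, t, hxF, ht, -, -, hx, hw⟩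
  have hμd : μ d ≤ 0 := by
    refine le_of_tendsto' (hw μ) fun k => ?_
    rw [map_smul, smul_eq_mul]
    exact mul_nonpos_of_nonneg_of_nonpos (inv_nonneg.2 (ht k).le) (hμ.2 _ (hxF k).1)
  obtain ⟨B, hB⟩ := aux_weak_bounded _ _ hw
  have hB0 : 0 ≤ B := (norm_nonneg _).trans (hB 0)
  have hlim := hw (l.comp (G' xbar))
  have hld : l.comp (G' xbar) d ≤ 0 := by
    have key : ∀ ε > 0, l.comp (G' xbar) d ≤ ε * (‖l‖ * B) := by
      intro ε hε
      have hev := hx.eventually ((hGd xbar).isLittleO.def hε)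
      refine le_of_tendsto hlim (hev.mono fun k hk => ?_)
      have h1 := hl _ (hxF k).2
      have h2 : -(l (G (x k) - G xbar - G' xbar (x k - xbar))) ≤ ‖l‖ * (ε * ‖x k - xbar‖) :=
        (neg_le_abs _).trans ((l.le_opNorm _).trans (by gcongr))
      rw [map_sub] at h2
      have h3 : l (G' xbar (x k - xbar)) ≤ ‖l‖ * (ε * ‖x k - xbar‖) := by linarith
      have h4 := hB k
      rw [norm_smul, norm_inv, Real.norm_of_nonneg (ht k).le] at h4
      rw [map_smul, smul_eq_mul, ContinuousLinearMap.comp_apply]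
      calc (t k)⁻¹ * l (G' xbar (x k - xbar)) ≤ (t k)⁻¹ * (‖l‖ * (ε * ‖x k - xbar‖)) := by
            have := ht k
            gcongr
        _ = ε * (‖l‖ * ((t k)⁻¹ * ‖x k - xbar‖)) := by ring
        _ ≤ _ := by gcongr
    by_contra! hpos
    have hBl : 0 ≤ ‖l‖ * B := by positivity
    have h5 := key (l.comp (G' xbar) d / (2 * (‖l‖ * B + 1))) (by positivity)
    rw [div_mul_eq_mul_div, le_div_iff₀ (by positivity)] at h5
    nlinarith
  simp only [add_apply]
  linarith

lemma aux_frechet {X : Type*} [NormedAddCommGroup X] [NormedSpace ℝ X]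
    [TopologicalSpace.SeparableSpace X] (hrefl : IsReflexiveSpace X)
    (Q : Set X) (x0 : X) : polarCone (weakTangentCone Q x0) ⊆ frechetNormalCone Q x0 := by
  intro v hv ε hε
  by_contra! hcon
  have hpos : ∀ n : ℕ, (0:ℝ) < 1 / ((n:ℝ) + 1) := fun n => by positivity
  choose x hxQ hxn hxv using fun n : ℕ => hcon _ (hpos n)
  have htp : ∀ n, 0 < ‖x n - x0‖ := by
    intro n
    rw [norm_pos_iff]
    intro h
    have := hxv n
    simp [h] at this
  have ht0 : Tendsto (fun n => ‖x n - x0‖) atTop (𝓝 0) :=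
    squeeze_zero (fun n => norm_nonneg _) hxn tendsto_one_div_add_atTop_nhds_zero_nat
  obtain ⟨g, hg | hg⟩ := exists_increasing_or_nonincreasing_subseq (· ≥ ·) (fun n => ‖x n - x0‖)
  swap
  · have h1 : ∀ᶠ n in atTop, ‖x (g n) - x0‖ < ‖x (g 0) - x0‖ :=
      (ht0.comp g.strictMono.tendsto_atTop).eventually_lt_const (htp _)
    obtain ⟨n, hn, hn0⟩ := (h1.and (eventually_gt_atTop 0)).exists
    have := hg 0 n hn0
    simp only [ge_iff_le, not_le] at this
    linarith
  have hanti : Antitone (fun n => ‖x (g n) - x0‖) := by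
    intro m n hmn
    rcases hmn.eq_or_lt with rfl | h
    · exact le_rfl
    · exact hg m n h
  obtain ⟨d, φ, hφ, hd⟩ := aux_weak_compact hrefl
    (fun n => ‖x (g n) - x0‖⁻¹ • (x (g n) - x0)) 1 (fun n => by
      rw [norm_smul, norm_inv, norm_norm, inv_mul_cancel₀ (htp _).ne'])
  have htt : Tendsto (fun k => ‖x (g (φ k)) - x0‖) atTop (𝓝 0) :=
    ht0.comp (g.strictMono.tendsto_atTop.comp hφ.tendsto_atTop)
  have hdT : d ∈ weakTangentCone Q x0 := by
    refine ⟨fun k => x (g (φ k)), fun k => ‖x (g (φ k)) - x0‖, fun k => hxQ _, fun k => htp _,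
      fun m n h => hanti (hφ.monotone h), htt, ?_, hd⟩
    exact tendsto_iff_norm_sub_tendsto_zero.2 htt
  have h1 := hv d hdT
  have h2 : ε ≤ v d := by
    refine ge_of_tendsto' (hd v) fun k => ?_
    simp only [map_smul, smul_eq_mul]
    rw [inv_mul_eq_div, le_div_iff₀ (htp _)]
    exact (hxv _).le
  linarith

lemma aux_stationary {X Y : Type*} [NormedAddCommGroup X] [NormedSpace ℝ X]
    [NormedAddCommGroup Y] [NormedSpace ℝ Y]
    (G : X → Y) (A : X →L[ℝ] Y) (C : Set X) (K : Set Y)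
    (hCcv : Convex ℝ C) (hKne : K.Nonempty) (hKcv : Convex ℝ K)
    (xbar x : X) (hx : x ∈ C) (hA : HasFDerivAt G A x) (v : X →L[ℝ] ℝ) (ε k δ : ℝ) (hε : 0 < ε)
    (hk : 0 ≤ k) (hδ : ‖x - xbar‖ < δ)
    (hmin : ∀ y ∈ C, ‖y - xbar‖ ≤ δ →
      -v (x - xbar) + 2 * ε * ‖x - xbar‖ + k * Metric.infDist (G x) K ≤
      -v (y - xbar) + 2 * ε * ‖y - xbar‖ + k * Metric.infDist (G y) K + ε * dist y x) :
    ∀ c ∈ C, 0 ≤ -v (c - x) + 3 * ε * ‖c - x‖ +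
      k * (Metric.infDist (G x + A (c - x)) K - Metric.infDist (G x) K) := by
  intro c hc
  set d := c - x with hd
  refine le_of_forall_pos_le_add fun e he => ?_
  obtain ⟨e', he', hee⟩ : ∃ e' > 0, k * (e' * ‖d‖) ≤ e := by
    refine ⟨e / (k * ‖d‖ + 1), by positivity, ?_⟩
    have : k * (e / (k * ‖d‖ + 1) * ‖d‖) = e * (k * ‖d‖) / (k * ‖d‖ + 1) := by ring
    rw [this, div_le_iff₀ (by positivity)]
    linarith
  have hcont : Tendsto (fun t : ℝ => x + t • d) (𝓝[>] 0) (𝓝 x) := by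
    have : Continuous fun t : ℝ => x + t • d := by fun_prop
    have h := this.tendsto 0
    simp only [zero_smul, add_zero] at h
    exact h.mono_left nhdsWithin_le_nhds
  have ev1 := hcont.eventually (hA.isLittleO.def he')
  have ev2 : ∀ᶠ t in 𝓝[>] (0:ℝ), ‖x + t • d - xbar‖ < δ :=
    ((hcont.sub_const xbar).norm).eventually_lt_const hδ
  have ev3 : ∀ᶠ t in 𝓝[>] (0:ℝ), t ∈ Set.Ioo (0:ℝ) 1 := Ioo_mem_nhdsGT one_pos
  obtain ⟨t, h1, h2, ht0, ht1⟩ := (ev1.and (ev2.and ev3)).exists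
  have hyC : x + t • d ∈ C := hCcv.add_smul_sub_mem hx hc ⟨ht0.le, ht1.le⟩
  have hm := hmin _ hyC h2.le
  have hn : ‖x + t • d - xbar‖ ≤ ‖x - xbar‖ + t * ‖d‖ := by
    have : x + t • d - xbar = (x - xbar) + t • d := by abel
    rw [this]
    refine (norm_add_le _ _).trans ?_
    rw [norm_smul, Real.norm_of_nonneg ht0.le]
  have hds : dist (x + t • d) x = t * ‖d‖ := by
    rw [dist_eq_norm, add_sub_cancel_left, norm_smul, Real.norm_of_nonneg ht0.le]
  have hv : v (x + t • d - xbar) = v (x - xbar) + t * v d := by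
    have : x + t • d - xbar = (x - xbar) + t • d := by abel
    rw [this, map_add, map_smul]; rfl
  have hD1 : Metric.infDist (G (x + t • d)) K ≤
      Metric.infDist (G x + t • A d) K + e' * (t * ‖d‖) := by
    refine (Metric.infDist_le_infDist_add_dist (y := G x + t • A d)).trans ?_
    gcongr
    rw [add_sub_cancel_left, map_smul, norm_smul, Real.norm_of_nonneg ht0.le] at h1
    rw [dist_eq_norm, ← sub_sub]
    exact h1
  have hD2 : Metric.infDist (G x + t • A d) K ≤
      (1 - t) * Metric.infDist (G x) K + t * Metric.infDist (G x + A d) K := by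
    have : G x + t • A d = (1 - t) • G x + t • (G x + A d) := by
      rw [sub_smul, one_smul, smul_add]; abel
    rw [this]
    exact aux_infDist_convex K hKne hKcv _ _ _ _ (by linarith) ht0.le (by ring)
  rw [hds, hv] at hm
  have hD3 := mul_le_mul_of_nonneg_left (hD1.trans (add_le_add_left hD2 _)) hk
  have hn' := mul_le_mul_of_nonneg_left hn (by positivity : 0 ≤ 2 * ε)
  have hee' := mul_le_mul_of_nonneg_left hee ht0.le
  have : 0 ≤ t * (-v d + 3 * ε * ‖d‖ +
      k * (Metric.infDist (G x + A d) K - Metric.infDist (G x) K) + e) := by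
    nlinarith
  exact nonneg_of_mul_nonneg_right this ht0

lemma aux_approx {X Y : Type*} [NormedAddCommGroup X] [NormedSpace ℝ X] [CompleteSpace X]
    [NormedAddCommGroup Y] [NormedSpace ℝ Y]
    [TopologicalSpace.SeparableSpace X]
    (hrefl : IsReflexiveSpace X)
    (G : X → Y) (G' : X → X →L[ℝ] Y)
    (hGd : ∀ x, HasFDerivAt G (G' x) x)
    (C : Set X) (K : Set Y) (hCcl : IsClosed C) (hCcv : Convex ℝ C)
    (hKne : K.Nonempty) (hKcv : Convex ℝ K)
    (xbar : X) (hxC : xbar ∈ C) (hxK : G xbar ∈ K)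
    (hCC : CondCC G C K) (v : X →L[ℝ] ℝ)
    (hv : v ∈ frechetNormalCone {x | x ∈ C ∧ G x ∈ K} xbar) (ε η : ℝ) (hε : 0 < ε) (hη : 0 < η) :
    ∃ x, ‖x - xbar‖ < η ∧ ∃ w ∈ Mset G G' C K x 0, ‖w - v‖ ≤ 3 * ε := by
  obtain ⟨δ, hδ, hF⟩ := hv ε hε
  have hGc : Continuous G := continuous_iff_continuousAt.2 fun x => (hGd x).continuousAt
  let S : Set X := {x | x ∈ C ∧ ‖x - xbar‖ ≤ δ}
  have hScl : IsClosed S := hCcl.inter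
    (isClosed_le (f := fun x => ‖x - xbar‖) (by fun_prop) continuous_const)
  have hS0 : xbar ∈ S := ⟨hxC, by simpa using hδ.le⟩
  have hvb : ∀ x ∈ S, v (x - xbar) ≤ ‖v‖ * δ := by
    intro x hx
    refine (le_abs_self _).trans ((v.le_opNorm _).trans ?_)
    have := hx.2
    gcongr
  have hek : ∀ k : ℕ, ∃ x ∈ S,
      (-v (x - xbar) + 2 * ε * ‖x - xbar‖ + (k : ℝ) * Metric.infDist (G x) K ≤ 0) ∧
      ∀ y ∈ S, -v (x - xbar) + 2 * ε * ‖x - xbar‖ + (k : ℝ) * Metric.infDist (G x) K ≤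
        -v (y - xbar) + 2 * ε * ‖y - xbar‖ + (k : ℝ) * Metric.infDist (G y) K + ε * dist y x := by
    intro k
    have hc : Continuous fun x => Metric.infDist (G x) K :=
      (Metric.continuous_infDist_pt K).comp hGc
    obtain ⟨x, hxS, h1, h2⟩ := aux_ekeland S hScl
      (fun x => -v (x - xbar) + 2 * ε * ‖x - xbar‖ + (k : ℝ) * Metric.infDist (G x) K)
      (by fun_prop) (-(‖v‖ * δ)) (fun x hx => by
        have h1 := hvb x hx
        have h2 : 0 ≤ 2 * ε * ‖x - xbar‖ := by positivity
        have h3 : 0 ≤ (k : ℝ) * Metric.infDist (G x) K :=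
          mul_nonneg k.cast_nonneg Metric.infDist_nonneg
        linarith) xbar hS0 ε hε
    refine ⟨x, hxS, ?_, h2⟩
    simpa [Metric.infDist_zero_of_mem hxK] using h1
  choose x hxS hx0 hxmin using hek
  have hφ0 : ∀ k, -v (x k - xbar) + 2 * ε * ‖x k - xbar‖ ≤ 0 := fun k => by
    have h3 : 0 ≤ (k : ℝ) * Metric.infDist (G (x k)) K :=
      mul_nonneg k.cast_nonneg Metric.infDist_nonneg
    linarith [hx0 k]
  have hdist : Tendsto (fun k => Metric.infDist (G (x k)) K) atTop (𝓝 0) := by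
    refine squeeze_zero' (Eventually.of_forall fun k => Metric.infDist_nonneg) ?_
      (tendsto_const_div_atTop_nhds_zero_nat (‖v‖ * δ))
    filter_upwards [eventually_gt_atTop 0] with k hk
    rw [le_div_iff₀ (by exact_mod_cast hk), mul_comm]
    have h2 : 0 ≤ 2 * ε * ‖x k - xbar‖ := by positivity
    linarith [hx0 k, hvb _ (hxS k)]
  obtain ⟨z, φ, hφ, hz⟩ := aux_weak_compact hrefl x (‖xbar‖ + δ) (fun k => by
    have := norm_add_le xbar (x k - xbar)
    rw [add_sub_cancel] at this
    linarith [(hxS k).2])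
  let T : Set X := {y | y ∈ C ∧ ‖y - xbar‖ ≤ δ ∧ -v (y - xbar) + 2 * ε * ‖y - xbar‖ ≤ 0}
  have hTcl : IsClosed T := hCcl.inter
    ((isClosed_le (f := fun y => ‖y - xbar‖) (by fun_prop) continuous_const).inter
      (isClosed_le (f := fun y => -v (y - xbar) + 2 * ε * ‖y - xbar‖) (by fun_prop) continuous_const))
  have hTcv : Convex ℝ T := by
    rintro y ⟨hy1, hy2, hy3⟩ y' ⟨hy1', hy2', hy3'⟩ a b ha hb hab
    have he : a • y + b • y' - xbar = a • (y - xbar) + b • (y' - xbar) := by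
      have : xbar = a • xbar + b • xbar := by rw [← add_smul, hab, one_smul]
      nth_rewrite 1 [this]
      simp only [smul_sub]; abel
    have hn : ‖a • y + b • y' - xbar‖ ≤ a * ‖y - xbar‖ + b * ‖y' - xbar‖ := by
      rw [he]
      refine (norm_add_le _ _).trans ?_
      rw [norm_smul, norm_smul, Real.norm_of_nonneg ha, Real.norm_of_nonneg hb]
    refine ⟨hCcv hy1 hy1' ha hb hab, ?_, ?_⟩
    · have h1 := mul_le_mul_of_nonneg_left hy2 ha
      have h2 := mul_le_mul_of_nonneg_left hy2' hb
      have h3 : a * δ + b * δ = δ := by rw [← add_mul, hab, one_mul]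
      linarith
    · have hv' : v (a • y + b • y' - xbar) = a * v (y - xbar) + b * v (y' - xbar) := by
        rw [he, map_add, map_smul, map_smul]; rfl
      rw [hv']
      have h1 := mul_le_mul_of_nonneg_left hy3 ha
      have h2 := mul_le_mul_of_nonneg_left hy3' hb
      have h3 := mul_le_mul_of_nonneg_left hn (by positivity : 0 ≤ 2 * ε)
      nlinarith
  have hzT : z ∈ T := aux_weak_closed T hTcl hTcv (fun k => x (φ k)) z
    (fun k => ⟨(hxS _).1, (hxS _).2, hφ0 _⟩) hz
  have hGz : G z ∈ K := hCC (fun k => x (φ k)) z (fun k => (hxS _).1) hzT.1 hz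
    (hdist.comp hφ.tendsto_atTop)
  have hzx : z = xbar := by
    have h1 := hF z ⟨hzT.1, hGz⟩ hzT.2.1
    have h2 := hzT.2.2
    have h3 : ε * ‖z - xbar‖ ≤ 0 := by linarith
    have h4 : ‖z - xbar‖ ≤ 0 := by
      by_contra! h
      have := mul_pos hε h
      linarith
    exact sub_eq_zero.1 (norm_le_zero_iff.1 h4)
  have hv0 : Tendsto (fun k => v (x (φ k) - xbar)) atTop (𝓝 0) := by
    have := (hz v).sub_const (v xbar)
    rw [hzx, sub_self] at this
    simpa only [map_sub] using this
  have hmpos : 0 < 2 * ε * min η δ := by positivity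
  obtain ⟨j, hj⟩ := (hv0.eventually_lt_const hmpos).exists
  have hlt : ‖x (φ j) - xbar‖ < min η δ := by
    have h1 := hφ0 (φ j)
    have h2 : 2 * ε * ‖x (φ j) - xbar‖ < 2 * ε * min η δ := by linarith
    exact lt_of_mul_lt_mul_left h2 (by positivity)
  refine ⟨x (φ j), hlt.trans_le (min_le_left _ _), ?_⟩
  have hst := aux_stationary G (G' (x (φ j))) C K hCcv hKne hKcv xbar (x (φ j)) (hxS _).1 (hGd _) v ε
    (φ j : ℕ) δ hε (Nat.cast_nonneg _) (hlt.trans_le (min_le_right _ _))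
    (fun y hy hy' => hxmin (φ j) y ⟨hy, hy'⟩)
  obtain ⟨l, μ, p, hμ, hl, hp, hvp⟩ := aux_multiplier C K hCcv hKne hKcv (x (φ j)) (hxS _).1 v
    (G' (x (φ j))) (G (x (φ j))) (3 * ε) (φ j : ℕ) (by positivity) (Nat.cast_nonneg _) hst
  refine ⟨l.comp (G' (x (φ j))) + μ, ⟨l, μ, hμ, hl, rfl⟩, ?_⟩
  rw [norm_sub_rev, hvp, add_sub_cancel_right]
  exact hp

theorem stmt_16 {X Y : Type*} [NormedAddCommGroup X] [NormedSpace ℝ X] [CompleteSpace X]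
    [NormedAddCommGroup Y] [NormedSpace ℝ Y] [CompleteSpace Y]
    [TopologicalSpace.SeparableSpace X]
    (hrefl : IsReflexiveSpace X)
    (G : X → Y) (G' : X → X →L[ℝ] Y)
    (hGd : ∀ x, HasFDerivAt G (G' x) x) (hGc : Continuous G')
    (C : Set X) (K : Set Y)
    (hCne : C.Nonempty) (hCcl : IsClosed C) (hCcv : Convex ℝ C)
    (hKne : K.Nonempty) (hKcl : IsClosed K) (hKcv : Convex ℝ K)
    (xbar : X) (hxC : xbar ∈ C) (hxK : G xbar ∈ K)
    (hreg : sAKKTRegular G G' C K xbar)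
    (hCC : CondCC G C K) :
    polarCone (weakTangentCone {x | x ∈ C ∧ G x ∈ K} xbar) =
      Mset G G' C K xbar 0 := by
  apply Set.Subset.antisymm _ (aux_easy G G' hGd C K xbar)
  intro v hv
  have hvF := aux_frechet hrefl _ _ hv
  have hpos : ∀ n : ℕ, (0:ℝ) < 1 / ((n:ℝ) + 1) := fun n => by positivity
  choose x hx w hw hwv using fun n : ℕ => aux_approx hrefl G G' hGd C K hCcl hCcv hKne hKcv xbar hxC
    hxK hCC v hvF _ _ (hpos n) (hpos n)
  have hlim := tendsto_one_div_add_atTop_nhds_zero_nat (𝕜 := ℝ)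
  refine hreg v x (fun _ => 0) w ?_ ⟨fun _ => le_rfl, antitone_const, tendsto_const_nhds⟩ ?_ hw
  · exact tendsto_iff_norm_sub_tendsto_zero.2
      (squeeze_zero (fun n => norm_nonneg _) (fun n => (hx n).le) hlim)
  · refine tendsto_iff_norm_sub_tendsto_zero.2
      (squeeze_zero (fun n => norm_nonneg _) hwv ?_)
    simpa using hlim.const_mul 3
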